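/- There exists a finite simple graph G = (V,E) with a rotation system such that every vertex of G has degree 3, 4, or 5, G has low edge density (for every S ⊆ V, the number of edges with both endpoints in S is at most 2|S|), and (G, rotation system) admits no angle cover. -/

import Mathlib

open SimpleGraph

/-- A rotation system on a simple graph `G`: for each vertex `v`, a permutation of
`Sym2 V` that fixes all non-incident edges and acts as a single cycle on the set of
edges incident to `v` (a cyclic ordering of the incident edges). -/
structure RotationSystem {V : Type*} (G : SimpleGraph V) where
  rot : V → Equiv.Perm (Sym2 V)
  fixes : ∀ v e, e ∉ G.incidenceSet v → rot v e = e
  cyclic : ∀ v, ∀ e ∈ G.incidenceSet v, ∀ e' ∈ G.incidenceSet v,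
    ∃ n : ℕ, ((rot v) ^ n) e = e'

/-- Two distinct edges incident to `v` are consecutive at `v` if they are adjacent
in the cyclic ordering given by the rotation system. -/
def RotationSystem.Consecutive {V : Type*} {G : SimpleGraph V} (ρ : RotationSystem G)
    (v : V) (e e' : Sym2 V) : Prop :=
  e ≠ e' ∧ e ∈ G.incidenceSet v ∧ e' ∈ G.incidenceSet v ∧
    (ρ.rot v e = e' ∨ ρ.rot v e' = e)

/-- An angle cover: each vertex `v` gets at most two incident edges, pairwise
consecutive at `v`, and every edge is covered at one of its endpoints. -/
def RotationSystem.IsAngleCover {V : Type*} {G : SimpleGraph V} (ρ : RotationSystem G)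
    (A : V → Finset (Sym2 V)) : Prop :=
  (∀ v, (A v).card ≤ 2) ∧
  (∀ v, ∀ e ∈ A v, e ∈ G.incidenceSet v) ∧
  (∀ v, ∀ e ∈ A v, ∀ e' ∈ A v, e ≠ e' → ρ.Consecutive v e e') ∧
  (∀ e ∈ G.edgeSet, ∃ v, v ∈ e ∧ e ∈ A v)

def exG : SimpleGraph (Fin 6) where
  Adj u v := u ≠ v ∧ (u < 3 ∨ v < 3)
  symm := ⟨fun _ _ h => ⟨h.1.symm, h.2.symm⟩⟩
  loopless := ⟨fun _ h => h.1 rfl⟩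

instance exDec : DecidableRel exG.Adj := fun u v =>
  inferInstanceAs (Decidable (u ≠ v ∧ (u < 3 ∨ v < 3)))

def exNb : Fin 6 → List (Fin 6) :=
  ![[3, 2, 5, 1, 4], [3, 0, 5, 2, 4], [3, 1, 5, 0, 4], [0, 1, 2], [1, 2, 0], [1, 2, 0]]

def exL (v : Fin 6) : List (Sym2 (Fin 6)) := (exNb v).map fun w => s(v, w)

theorem exL_nodup : ∀ v, (exL v).Nodup := by decide

theorem exL_mem (v : Fin 6) (e : Sym2 (Fin 6)) : e ∈ exL v ↔ e ∈ exG.incidenceSet v := by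
  have h : ∀ v a b : Fin 6, s(a, b) ∈ exL v ↔ (exG.Adj a b ∧ (v = a ∨ v = b)) := by
    decide +kernel
  induction e with
  | _ a b =>
    rw [h]
    simp [SimpleGraph.incidenceSet]

def exRho : RotationSystem exG where
  rot v := (exL v).formPerm
  fixes v e h := List.formPerm_apply_of_notMem (by rwa [exL_mem])
  cyclic v e he e' he' := by
    rw [← exL_mem] at he he'
    have h : ∀ v : Fin 6, ∀ e ∈ exL v, ∀ e' ∈ exL v,
        ∃ n : Fin 5, ((exL v).formPerm ^ (n : ℕ)) e = e' := by decide +kernel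
    obtain ⟨n, hn⟩ := h v e he e' he'
    exact ⟨n, hn⟩

theorem exNoCons : ∀ v a b : Fin 6, (v, a, b) ∈
    ([(0,3,5),(0,3,1),(0,2,1),(0,2,4),(0,5,4),
      (1,3,5),(1,3,2),(1,0,2),(1,0,4),(1,5,4),
      (2,3,5),(2,3,0),(2,1,0),(2,1,4),(2,5,4)] : List (Fin 6 × Fin 6 × Fin 6)) →
    s(v, a) ≠ s(v, b) ∧ ¬ ((exL v).formPerm s(v, a) = s(v, b) ∨
      (exL v).formPerm s(v, b) = s(v, a)) := by decide +kernel

theorem exNoCover (A : Fin 6 → Finset (Sym2 (Fin 6))) (hA : exRho.IsAngleCover A) : False := by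
  obtain ⟨h1, -, h3, h4⟩ := hA
  have key : ∀ v a b : Fin 6, (v, a, b) ∈
    ([(0,3,5),(0,3,1),(0,2,1),(0,2,4),(0,5,4),
      (1,3,5),(1,3,2),(1,0,2),(1,0,4),(1,5,4),
      (2,3,5),(2,3,0),(2,1,0),(2,1,4),(2,5,4)] : List (Fin 6 × Fin 6 × Fin 6)) →
      ¬ (s(v, a) ∈ A v ∧ s(v, b) ∈ A v) := by
    rintro v a b h ⟨ha, hb⟩
    obtain ⟨hne, hc⟩ := exNoCons v a b h
    exact hc (h3 v _ ha _ hb hne).2.2.2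
  have tri : ∀ v : Fin 6, 3 ≤ v → ¬ (s(v, 0) ∈ A v ∧ s(v, 1) ∈ A v ∧ s(v, 2) ∈ A v) := by
    rintro v hv ⟨ha, hb, hc⟩
    have := Finset.two_lt_card.2 ⟨_, ha, _, hb, _, hc, by clear ha hb hc; revert v; decide, by clear ha hb hc; revert v; decide,
      by clear ha hb hc; revert v; decide⟩
    have := h1 v
    omega
  have cov : ∀ u v : Fin 6, exG.Adj u v → s(u, v) ∈ A u ∨ s(v, u) ∈ A v := by
    intro u v h
    obtain ⟨w, hw, hm⟩ := h4 s(u, v) h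
    rcases Sym2.mem_iff.1 hw with rfl | rfl
    · exact Or.inl hm
    · exact Or.inr (Sym2.eq_swap ▸ hm)
  generalize hx : (fun u v : Fin 6 => s(u, v) ∈ A u) = x at *
  have hx' : ∀ u v, (s(u, v) ∈ A u) = x u v := by intro u v; rw [← hx]
  simp only [hx'] at key tri cov
  have k1 := key 0 3 5 (by decide)
  have k2 := key 0 3 1 (by decide)
  have k3 := key 0 2 1 (by decide)
  have k4 := key 0 2 4 (by decide)
  have k5 := key 0 5 4 (by decide)
  have l1 := key 1 3 5 (by decide)
  have l2 := key 1 3 2 (by decide)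
  have l3 := key 1 0 2 (by decide)
  have l4 := key 1 0 4 (by decide)
  have l5 := key 1 5 4 (by decide)
  have m1 := key 2 3 5 (by decide)
  have m2 := key 2 3 0 (by decide)
  have m3 := key 2 1 0 (by decide)
  have m4 := key 2 1 4 (by decide)
  have m5 := key 2 5 4 (by decide)
  have t3 := tri 3 (by decide)
  have t4 := tri 4 (by decide)
  have t5 := tri 5 (by decide)
  have c01 := cov 0 1 (by decide)
  have c02 := cov 0 2 (by decide)
  have c12 := cov 1 2 (by decide)
  have c03 := cov 0 3 (by decide)
  have c04 := cov 0 4 (by decide)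
  have c05 := cov 0 5 (by decide)
  have c13 := cov 1 3 (by decide)
  have c14 := cov 1 4 (by decide)
  have c15 := cov 1 5 (by decide)
  have c23 := cov 2 3 (by decide)
  have c24 := cov 2 4 (by decide)
  have c25 := cov 2 5 (by decide)
  clear key tri cov hx' hx h1 h3 h4
  grind


theorem exDens (S : Finset (Fin 6)) :
    ({e ∈ exG.edgeSet | ∀ v ∈ e, v ∈ S} : Set (Sym2 (Fin 6))).ncard ≤ 2 * S.card := by
  have h : ∀ S : Finset (Fin 6),
      (exG.edgeFinset.filter fun e => ∀ v ∈ e, v ∈ S).card ≤ 2 * S.card := by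
    decide +kernel
  refine le_trans (le_of_eq ?_) (h S)
  rw [← Set.ncard_coe_finset]
  congr 1
  ext e
  simp

/-- There is a finite simple graph with all vertex degrees in {3,4,5}, with a rotation
system, having low edge density but admitting no angle cover. -/
theorem exists_degrees_345_low_density_no_angleCover :
    ∃ (V : Type) (_ : Fintype V) (G : SimpleGraph V) (ρ : RotationSystem G),
      (∀ v, (G.neighborSet v).ncard = 3 ∨ (G.neighborSet v).ncard = 4 ∨
        (G.neighborSet v).ncard = 5) ∧
      (∀ S : Finset V, ({e ∈ G.edgeSet | ∀ v ∈ e, v ∈ S} : Set (Sym2 V)).ncard ≤ 2 * S.card) ∧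
      ¬∃ A : V → Finset (Sym2 V), ρ.IsAngleCover A := by
  refine ⟨Fin 6, inferInstance, exG, exRho, ?_, exDens, fun ⟨A, hA⟩ => exNoCover A hA⟩
  have h : ∀ v, exG.degree v = 3 ∨ exG.degree v = 4 ∨ exG.degree v = 5 := by decide +kernel
  intro v
  have e : (exG.neighborSet v).ncard = exG.degree v := by
    rw [← SimpleGraph.card_neighborFinset_eq_degree, ← Set.ncard_coe_finset,
      SimpleGraph.coe_neighborFinset]
  rw [e]
  exact h v
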